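/- For every real number ξ irrational and every nonempty open interval I ⊆ [0,1), the set A = {n ∈ ℕ : {ν_2(n)·ξ} ∈ I} is multiplicatively syndetic in (ℕ,·), where ν_2(n) is the 2-adic valuation of n and {x} denotes the fractional part. -/

import Mathlib

/-- Orbits of an irrational rotation meet a nonempty open set within uniformly bounded time. -/
theorem AddCircle.exists_finset_add_nsmul_mem {ξ : ℝ} (hξ : Irrational ξ)
    {U : Set (AddCircle (1 : ℝ))} (hU : IsOpen U) (hne : U.Nonempty) :
    ∃ t : Finset ℕ, ∀ x : AddCircle (1 : ℝ), ∃ k ∈ t, x + k • (ξ : AddCircle (1 : ℝ)) ∈ U := by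
  have hdense : DenseRange (fun k : ℕ => k • (ξ : AddCircle (1 : ℝ))) :=
    denseRange_zsmul_iff_nsmul.mp (AddCircle.denseRange_zsmul_coe_iff.mpr (by simpa using hξ))
  obtain ⟨t, ht⟩ := isCompact_univ.elim_finite_subcover
    (fun k : ℕ => (fun x : AddCircle (1 : ℝ) => x + k • (ξ : AddCircle (1 : ℝ))) ⁻¹' U)
    (fun k => hU.preimage (continuous_add_const _)) (fun x _ => by
      obtain ⟨u, hu⟩ := hne
      obtain ⟨k, hk⟩ := hdense.exists_mem_open (hU.preimage (continuous_const_add x))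
        ⟨-x + u, by simpa using hu⟩
      exact Set.mem_iUnion.mpr ⟨k, hk⟩)
  refine ⟨t, fun x => ?_⟩
  simpa using ht (Set.mem_univ x)

/-- A real number whose class on the unit circle comes from a subset of `[0, 1)` has its
fractional part in that subset. -/
theorem AddCircle.fract_mem_of_coe_mem_image {s : Set ℝ} (hs : s ⊆ Set.Ico 0 1) {x : ℝ}
    (hx : (x : AddCircle (1 : ℝ)) ∈ ((↑) : ℝ → AddCircle (1 : ℝ)) '' s) : Int.fract x ∈ s := by
  obtain ⟨y, hy, hyx⟩ := hx
  have h : ((x - y : ℝ) : AddCircle (1 : ℝ)) = 0 := by rw [AddCircle.coe_sub, hyx, sub_self]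
  obtain ⟨m, hm⟩ := (AddCircle.coe_eq_zero_iff 1).mp h
  have hfract : Int.fract x = y :=
    Int.fract_eq_iff.mpr ⟨(hs hy).1, (hs hy).2, m, by simpa using hm.symm⟩
  rwa [hfract]

/-- For ξ irrational and a nonempty open interval (a,b) ⊆ [0,1), the set
{n : {ν₂(n)·ξ} ∈ (a,b)} is multiplicatively syndetic in (ℕ,·). -/
theorem nu_two_fract_mult_syndetic (ξ : ℝ) (hξ : Irrational ξ)
    (a b : ℝ) (h0 : 0 ≤ a) (hab : a < b) (h1 : b ≤ 1) :
    ∃ F : Finset ℕ, (∀ f ∈ F, 0 < f) ∧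
      ∀ n : ℕ, 0 < n → ∃ f ∈ F,
        Int.fract ((padicValNat 2 (n * f) : ℝ) * ξ) ∈ Set.Ioo a b := by
  obtain ⟨t, ht⟩ := AddCircle.exists_finset_add_nsmul_mem hξ
    (QuotientAddGroup.isOpenMap_coe (Set.Ioo a b) isOpen_Ioo) ((Set.nonempty_Ioo.mpr hab).image _)
  refine ⟨t.image (2 ^ ·), by simp, fun n hn => ?_⟩
  obtain ⟨k, hk, hmem⟩ := ht (((padicValNat 2 n : ℝ) * ξ : ℝ) : AddCircle (1 : ℝ))
  refine ⟨2 ^ k, Finset.mem_image_of_mem _ hk, AddCircle.fract_mem_of_coe_mem_image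
    (fun y hy => ⟨h0.trans hy.1.le, hy.2.trans_le h1⟩) ?_⟩
  rw [padicValNat.mul hn.ne' (by positivity), padicValNat.prime_pow, Nat.cast_add, add_mul,
    AddCircle.coe_add, ← nsmul_eq_mul k, AddCircle.coe_nsmul]
  exact hmem
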